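/- If X is a simple object of a fusion category with Frobenius-Perron dimension strictly less than 2, then FPdim(X) = 2·cos(π/n) for some integer n ≥ 3. -/

import Mathlib

open scoped BigOperators
open Real

/-- A fusion ring: the Grothendieck-ring data of a fusion category, with basis `I`
(the isomorphism classes of simple objects), fusion multiplicities `N`, unit,
duality, and Frobenius–Perron dimensions `d`. -/
structure FusionRing (I : Type) [Fintype I] [DecidableEq I] where
  N : I → I → I → ℕ
  one : I
  dual : I → I
  d : I → ℝ
  d_one : d one = 1
  one_le_d : ∀ i, 1 ≤ d i
  dual_dual : ∀ i, dual (dual i) = i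
  d_dual : ∀ i, d (dual i) = d i
  d_mul : ∀ i j, d i * d j = ∑ k, (N i j k : ℝ) * d k
  N_one_left : ∀ i k, N one i k = if k = i then 1 else 0
  N_one_right : ∀ i k, N i one k = if k = i then 1 else 0
  N_unit : ∀ i j, N i j one = if j = dual i then 1 else 0
  assoc : ∀ i j k l, ∑ m, N i j m * N m k l = ∑ m, N j k m * N i m l

/-- A faithfully `G`-graded fusion ring: the Grothendieck data of a faithful
`G`-extension `C = ⊕_{g ∈ G} C_g` of the fusion category `D = C_e`. -/
structure GradedFusionRing (G : Type) [Group G] [Fintype G] [DecidableEq G]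
    (I : Type) [Fintype I] [DecidableEq I] extends FusionRing I where
  deg : I → G
  deg_one : deg one = 1
  deg_mul : ∀ i j k, N i j k ≠ 0 → deg k = deg i * deg j
  faithful : Function.Surjective deg

open Polynomial IntermediateField in
/-- An algebraic integer `δ` with `0 ≤ δ < 2` all of whose conjugates are real and bounded by `δ` in
absolute value has the form `2 * cos (π / n)`. -/
theorem exists_eq_two_mul_cos_pi_div (p : ℤ[X]) (hp : p.Monic) (δ : ℝ) (hδ0 : 0 ≤ δ) (hδ2 : δ < 2)
    (hδ : aeval (δ : ℂ) p = 0) (him : ∀ μ : ℂ, aeval μ p = 0 → μ.im = 0)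
    (hnorm : ∀ μ : ℂ, aeval μ p = 0 → ‖μ‖ ≤ δ) :
    ∃ n : ℕ, 0 < n ∧ δ = 2 * Real.cos (Real.pi / n) := by
  set θ := Real.arccos (δ / 2) with hθ
  have hcos : δ = 2 * Real.cos θ := by
    rw [hθ, Real.cos_arccos (by linarith) (by linarith)]; ring
  have hθ0 : 0 < θ := Real.arccos_pos.2 (by linarith)
  have hθπ : θ ≤ Real.pi := Real.arccos_le_pi _
  set z : ℂ := Complex.exp (θ * Complex.I) with hz
  have hz0 : z ≠ 0 := Complex.exp_ne_zero _
  have hexp : ∀ t : ℝ, Complex.exp (t * Complex.I) + (Complex.exp (t * Complex.I))⁻¹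
      = ((2 * Real.cos t : ℝ) : ℂ) := by
    intro t
    rw [← Complex.exp_neg]
    push_cast
    rw [Complex.two_cos]
    ring_nf
  have hzδ : z + z⁻¹ = δ := by rw [hz, hexp, hcos]
  have hzint : IsIntegral ℤ z := by
    have hδint : IsIntegral ℤ (δ : ℂ) := ⟨p, hp, hδ⟩
    let a : integralClosure ℤ ℂ := ⟨δ, hδint⟩
    refine isIntegral_trans (A := integralClosure ℤ ℂ) z ⟨X ^ 2 - C a * X + 1, by monicity!, ?_⟩
    have : (algebraMap (integralClosure ℤ ℂ) ℂ) a = z + z⁻¹ := hzδ.symm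
    simp only [eval₂_add, eval₂_sub, eval₂_mul, eval₂_pow, eval₂_X, eval₂_C, eval₂_one, this]
    field_simp
    ring
  have hzQ : IsIntegral ℚ z := hzint.tower_top
  have : FiniteDimensional ℚ ℚ⟮z⟯ := adjoin.finiteDimensional hzQ
  have : NumberField ℚ⟮z⟯ := {}
  set y : ℚ⟮z⟯ := AdjoinSimple.gen ℚ z with hy
  have hyz : algebraMap ℚ⟮z⟯ ℂ y = z := AdjoinSimple.algebraMap_gen ℚ z
  have hroot : aeval (y + y⁻¹) p = 0 := by
    apply (algebraMap ℚ⟮z⟯ ℂ).injective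
    rw [map_zero, ← aeval_algebraMap_apply, map_add, map_inv₀, hyz, hzδ, hδ]
  have hφ : ∀ φ : ℚ⟮z⟯ →+* ℂ, aeval (φ y + (φ y)⁻¹) p = 0 := by
    intro φ
    have h := congrArg φ hroot
    rw [map_zero] at h
    have h2 := aeval_algHom_apply φ.toIntAlgHom (y + y⁻¹) p
    simp only [RingHom.toIntAlgHom_apply, map_add, map_inv₀] at h2
    rw [h2, h]
  have hy0 : y ≠ 0 := by
    intro h
    rw [h, map_zero] at hyz
    exact hz0 hyz.symm
  have hunit : ∀ w : ℂ, w ≠ 0 → (w + w⁻¹).im = 0 → ‖w + w⁻¹‖ < 2 → ‖w‖ = 1 := by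
    intro w hw h1 h2
    have hN : Complex.normSq w ≠ 0 := by simpa using hw
    have h3 : w.im = 0 ∨ Complex.normSq w = 1 := by
      rw [Complex.add_im, Complex.inv_im] at h1
      field_simp at h1
      have : w.im * (Complex.normSq w - 1) = 0 := by linarith
      rcases mul_eq_zero.1 this with h | h
      · exact Or.inl h
      · exact Or.inr (by linarith)
    rcases h3 with h3 | h3
    · exfalso
      have hwr : w = (w.re : ℂ) := by apply Complex.ext <;> simp [h3]
      have hr0 : w.re ≠ 0 := by
        intro h
        rw [h] at hwr
        exact hw (by simpa using hwr)
      rw [hwr, ← Complex.ofReal_inv, ← Complex.ofReal_add, Complex.norm_real, Real.norm_eq_abs] at h2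
      have h4 : (w.re + w.re⁻¹) ^ 2 < 4 := by
        have := sq_lt_sq' (abs_lt.1 h2).1 (abs_lt.1 h2).2
        linarith
      have h5 : (w.re + w.re⁻¹) ^ 2 = (w.re - w.re⁻¹) ^ 2 + 4 := by field_simp; ring
      nlinarith [sq_nonneg (w.re - w.re⁻¹)]
    · rw [← sq_eq_sq₀ (norm_nonneg _) zero_le_one, ← Complex.normSq_eq_norm_sq, h3, one_pow]
  obtain ⟨k, hk, hyk⟩ := NumberField.Embeddings.pow_eq_one_of_norm_eq_one ℚ⟮z⟯ ℂ (x := y)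
    (by
      rw [← isIntegral_algebraMap_iff (algebraMap ℚ⟮z⟯ ℂ).injective, hyz]
      exact hzint)
    (fun φ => hunit _ (by simpa using hy0) (him _ (hφ φ)) ((hnorm _ (hφ φ)).trans_lt hδ2))
  have hzk : z ^ k = 1 := by rw [← hyz, ← map_pow, hyk, map_one]
  have hm : 0 < orderOf z := orderOf_pos_iff.2 (isOfFinOrder_iff_pow_eq_one.2 ⟨k, hk, hzk⟩)
  have hprim := IsPrimitiveRoot.orderOf z
  set m := orderOf z
  have hconj : ∀ w : ℂ, IsPrimitiveRoot w m → ‖w + w⁻¹‖ ≤ δ := by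
    intro w hw
    have hmem : w ∈ (minpoly ℚ z).aroots ℂ := by
      rw [← cyclotomic_eq_minpoly_rat hprim hm, cyclotomic_eq_minpoly_rat hw hm, mem_aroots]
      exact ⟨minpoly.ne_zero (hw.isIntegral hm).tower_top, minpoly.aeval _ _⟩
    have h := hφ ((algHomAdjoinIntegralEquiv ℚ hzQ).symm ⟨w, hmem⟩ : ℚ⟮z⟯ →ₐ[ℚ] ℂ).toRingHom
    have hg : ((algHomAdjoinIntegralEquiv ℚ hzQ).symm ⟨w, hmem⟩ : ℚ⟮z⟯ →ₐ[ℚ] ℂ) y = w :=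
      algHomAdjoinIntegralEquiv_symm_apply_gen ℚ hzQ ⟨w, hmem⟩
    simp only [AlgHom.toRingHom_eq_coe, RingHom.coe_coe, hg] at h
    exact hnorm _ h
  obtain ⟨n, hn, hzn, w, hw, hwn⟩ : ∃ n : ℕ, 0 < n ∧ z ^ (2 * n) = 1 ∧ ∃ w : ℂ,
      IsPrimitiveRoot w m ∧ ‖w + w⁻¹‖ = |2 * Real.cos (Real.pi / n)| := by
    have hcosn : ∀ n : ℕ, ‖Complex.exp ((Real.pi / n : ℝ) * Complex.I)
        + (Complex.exp ((Real.pi / n : ℝ) * Complex.I))⁻¹‖ = |2 * Real.cos (Real.pi / n)| := by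
      intro n
      rw [hexp, Complex.norm_real, Real.norm_eq_abs]
    have hzm : z ^ m = 1 := hprim.pow_eq_one
    rcases Nat.even_or_odd' m with ⟨n, hn | hn⟩
    · have hn0 : 0 < n := by omega
      refine ⟨n, hn0, hn ▸ hzm, _, ?_, hcosn n⟩
      convert Complex.isPrimitiveRoot_exp m hm.ne' using 2
      rw [hn]
      have : (n : ℂ) ≠ 0 := by exact_mod_cast hn0.ne'
      push_cast
      field_simp
    · refine ⟨m, hm, by rw [mul_comm, pow_mul, hzm, one_pow],
        -Complex.exp ((Real.pi / m : ℝ) * Complex.I), ?_, ?_⟩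
      · have hcop : (n + 1).Coprime m := by
          rw [hn, show 2 * n + 1 = (n + 1) + n by ring]
          simp
        convert Complex.isPrimitiveRoot_exp_of_coprime (n + 1) m hm.ne' hcop using 1
        have hmC : (m : ℂ) ≠ 0 := by exact_mod_cast hm.ne'
        have hmn : (m : ℂ) = 2 * n + 1 := by exact_mod_cast hn
        rw [← neg_one_mul, ← Complex.exp_pi_mul_I, ← Complex.exp_add]
        congr 1
        push_cast
        field_simp
        rw [hmn]
        ring
      · rw [inv_neg, ← neg_add, norm_neg, hcosn]
  have hnR : (0 : ℝ) < n := by exact_mod_cast hn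
  refine ⟨n, hn, le_antisymm ?_ ?_⟩
  · have hle : Real.pi / n ≤ θ := by
      rw [hz, ← Complex.exp_nat_mul, Complex.exp_eq_one_iff] at hzn
      obtain ⟨j, hj⟩ := hzn
      have hj' : (n : ℝ) * θ = j * Real.pi := by
        have h := congrArg Complex.im hj
        simp at h
        linarith
      have hjpos : 0 < j := by
        have : (0 : ℝ) < j * Real.pi := hj' ▸ mul_pos hnR hθ0
        exact_mod_cast pos_of_mul_pos_left this Real.pi_pos.le
      have hj1 : (1 : ℝ) ≤ j := by exact_mod_cast hjpos
      rw [div_le_iff₀ hnR]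
      nlinarith [Real.pi_pos]
    have := Real.cos_le_cos_of_nonneg_of_le_pi (by positivity) hθπ hle
    linarith
  · exact (le_abs_self _).trans (hwn ▸ hconj w hw)

open Polynomial Matrix in
theorem Matrix.aeval_charpoly_eq_zero_iff_exists_mulVec_eq_smul {n : Type*} [Fintype n]
    [DecidableEq n] (A : Matrix n n ℤ) (μ : ℂ) :
    aeval μ A.charpoly = 0 ↔ ∃ w : n → ℂ, w ≠ 0 ∧ A.map (Int.cast : ℤ → ℂ) *ᵥ w = μ • w := by
  have h : aeval μ A.charpoly = (A.map (Int.cast : ℤ → ℂ)).charpoly.eval μ := by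
    rw [show A.map (Int.cast : ℤ → ℂ) = A.map (Int.castRingHom ℂ) from rfl, Matrix.charpoly_map,
      eval_map]
    rfl
  rw [h, Matrix.eval_charpoly, ← Matrix.exists_mulVec_eq_zero_iff]
  refine exists_congr fun w => and_congr_right fun _ => ?_
  rw [Matrix.sub_mulVec, sub_eq_zero, eq_comm]
  simp [Matrix.scalar_apply]

open Matrix ComplexOrder in
theorem Matrix.im_eq_zero_of_mulVec_eq_smul {n : Type*} [Fintype n] (A : Matrix n n ℂ)
    (hA : A.IsHermitian) (μ : ℂ) (w : n → ℂ) (hw : w ≠ 0) (h : A *ᵥ w = μ • w) : μ.im = 0 := by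
  have h1 : star w ⬝ᵥ A *ᵥ w = μ * (star w ⬝ᵥ w) := by rw [h, dotProduct_smul, smul_eq_mul]
  have h2 : star w ⬝ᵥ A *ᵥ w = star μ * (star w ⬝ᵥ w) := by
    have : star w ᵥ* A = star (A *ᵥ w) := by rw [Matrix.star_mulVec, hA.eq]
    rw [Matrix.dotProduct_mulVec, this, h, star_smul, smul_dotProduct, smul_eq_mul]
  have h3 : star w ⬝ᵥ w ≠ 0 := mt dotProduct_star_self_eq_zero.1 hw
  exact Complex.conj_eq_iff_im.1 (mul_right_cancel₀ h3 (h2.symm.trans h1))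

open Matrix in
theorem Matrix.norm_le_of_mulVec_eq_smul {n : Type*} [Fintype n] (A : Matrix n n ℝ)
    (hA : ∀ i j, 0 ≤ A i j) (v : n → ℝ) (hv : ∀ i, 0 < v i) (δ : ℝ) (hAv : A *ᵥ v = δ • v)
    (μ : ℂ) (w : n → ℂ) (hw : w ≠ 0) (h : A.map (Complex.ofReal) *ᵥ w = μ • w) : ‖μ‖ ≤ δ := by
  obtain ⟨i₀, hi₀⟩ := Function.ne_iff.1 hw
  obtain ⟨i, -, hi⟩ := Finset.exists_max_image Finset.univ (fun i => ‖w i‖ / v i) ⟨i₀, by simp⟩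
  set c := ‖w i‖ / v i with hc
  have hcw : ∀ j, ‖w j‖ ≤ c * v j := fun j => (div_le_iff₀ (hv j)).1 (hi j (by simp))
  have hc0 : 0 < c := (div_pos (norm_pos_iff.2 hi₀) (hv i₀)).trans_le (hi i₀ (by simp))
  have hwi : ‖w i‖ = c * v i := by rw [hc, div_mul_cancel₀ _ (hv i).ne']
  have key : ‖μ‖ * (c * v i) ≤ δ * (c * v i) := by
    calc ‖μ‖ * (c * v i) = ‖(A.map (Complex.ofReal) *ᵥ w) i‖ := by
          rw [h, Pi.smul_apply, smul_eq_mul, norm_mul, hwi]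
      _ ≤ ∑ j, A i j * ‖w j‖ := by
          refine (norm_sum_le _ _).trans (Finset.sum_le_sum fun j _ => ?_)
          simp [abs_of_nonneg (hA i j)]
      _ ≤ ∑ j, A i j * (c * v j) :=
          Finset.sum_le_sum fun j _ => mul_le_mul_of_nonneg_left (hcw j) (hA i j)
      _ = c * (A *ᵥ v) i := by
          rw [Matrix.mulVec, dotProduct, Finset.mul_sum]
          exact Finset.sum_congr rfl fun j _ => by ring
      _ = δ * (c * v i) := by rw [hAv, Pi.smul_apply, smul_eq_mul]; ring
  exact le_of_mul_le_mul_right key (mul_pos hc0 (hv i))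

open Matrix in
/-- Kronecker's theorem for symmetric nonnegative integer matrices with a positive eigenvector. -/
theorem Matrix.exists_eq_two_mul_cos_pi_div {n : Type*} [Fintype n] [Nonempty n] (A : Matrix n n ℕ)
    (hA : A.IsSymm) (v : n → ℝ) (hv : ∀ i, 0 < v i) (δ : ℝ)
    (hAv : A.map (Nat.cast : ℕ → ℝ) *ᵥ v = δ • v) (hδ0 : 0 ≤ δ) (hδ2 : δ < 2) :
    ∃ k : ℕ, 0 < k ∧ δ = 2 * Real.cos (Real.pi / k) := by
  classical
  let B : Matrix n n ℤ := A.map (Nat.cast : ℕ → ℤ)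
  have hBR : B.map (Int.cast : ℤ → ℂ) = (A.map (Nat.cast : ℕ → ℝ)).map Complex.ofReal := by
    ext i j; simp [B]
  refine _root_.exists_eq_two_mul_cos_pi_div B.charpoly B.charpoly_monic δ hδ0 hδ2 ?_ ?_ ?_
  · refine (B.aeval_charpoly_eq_zero_iff_exists_mulVec_eq_smul δ).2 ⟨fun i => (v i : ℂ), ?_, ?_⟩
    · obtain ⟨i⟩ := ‹Nonempty n›
      exact Function.ne_iff.2 ⟨i, by simpa using (hv i).ne'⟩
    · ext i
      have h := congrArg Complex.ofReal (congrFun hAv i)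
      rw [hBR]
      simpa [Matrix.mulVec, dotProduct] using h
  · intro μ hμ
    obtain ⟨w, hw, h⟩ := (B.aeval_charpoly_eq_zero_iff_exists_mulVec_eq_smul μ).1 hμ
    refine Matrix.im_eq_zero_of_mulVec_eq_smul _ ?_ μ w hw h
    ext i j
    simp [B, hA.apply i j]
  · intro μ hμ
    obtain ⟨w, hw, h⟩ := (B.aeval_charpoly_eq_zero_iff_exists_mulVec_eq_smul μ).1 hμ
    exact Matrix.norm_le_of_mulVec_eq_smul _ (fun i j => by simp) v hv δ hAv μ w hw (hBR ▸ h)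

namespace FusionRing

variable {I : Type} [Fintype I] [DecidableEq I] (R : FusionRing I)

/-- Frobenius reciprocity: the multiplicity of the unit in `i ⊗ j ⊗ k` is cyclically invariant. -/
theorem N_dual_cyclic (i j k : I) : R.N i j (R.dual k) = R.N j k (R.dual i) := by
  have hd : ∀ m k : I, k = R.dual m ↔ m = R.dual k := fun m k =>
    ⟨fun h => by rw [h, R.dual_dual], fun h => by rw [h, R.dual_dual]⟩
  have h := R.assoc i j k R.one
  simpa [R.N_unit, hd _ k] using h

theorem sum_N_transpose_mul_d (i j : I) : ∑ k, (R.N i k j : ℝ) * R.d k = R.d i * R.d j := by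
  have hN : ∀ k, R.N i k j = R.N (R.dual j) i (R.dual k) := fun k => by
    rw [R.N_dual_cyclic (R.dual j) i k, R.dual_dual]
  have h := R.d_mul (R.dual j) i
  rw [R.d_dual] at h
  rw [mul_comm, h]
  refine Fintype.sum_equiv (Function.Involutive.toPerm R.dual R.dual_dual) _ _ fun k => ?_
  rw [hN, ← R.d_dual k]
  rfl

end FusionRing

/-- If `X` is a simple object of a fusion category with
Frobenius–Perron dimension strictly less than 2, then
`FPdim X = 2 cos (π / n)` for some integer `n ≥ 3`. -/
theorem stmt0 {I : Type} [Fintype I] [DecidableEq I] (R : FusionRing I)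
    (X : I) (hX : R.d X < 2) :
    ∃ n : ℕ, 3 ≤ n ∧ R.d X = 2 * Real.cos (Real.pi / n) := by
  classical
  let L : Matrix I I ℕ := Matrix.of (R.N X)
  let v : I ⊕ I → ℝ := Sum.elim R.d R.d
  have hX1 := R.one_le_d X
  have : Nonempty I := ⟨X⟩
  obtain ⟨n, hn, h⟩ := (Matrix.fromBlocks 0 L L.transpose 0).exists_eq_two_mul_cos_pi_div
    (by simp [Matrix.IsSymm, Matrix.fromBlocks_transpose]) v
    (by rintro (i | i) <;> exact zero_lt_one.trans_le (R.one_le_d i)) (R.d X)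
    (by
      ext (i | i)
      · simpa [Matrix.mulVec, dotProduct, v, L] using (R.d_mul X i).symm
      · simpa [Matrix.mulVec, dotProduct, v, L] using R.sum_N_transpose_mul_d X i)
    (by linarith) hX
  refine ⟨n, ?_, h⟩
  by_contra! hlt
  interval_cases n
  · norm_num at h
    linarith
  · norm_num at h
    linarith
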